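/- (Equivalence of Lolli and the backchaining specification logic.) A Lolli sequent Γ;Δ ⊢ G is provable in Lolli if and only if it is provable in the specification logic, where the specification logic consists of all the right-introduction rules of Lolli (⊤R, &R, ⊸R, ⇒R, ∀R, ∃R, !R, ⊕R, ⊗R) together with the two backchaining rules: BC_u: for a program clause B with B ∈ Γ and ⟨{B₁,…,Bₙ},{C₁,…,C_m},A⟩ ∈ ||B||, from premises Γ;∅ ⊢ Bⱼ for each j ∈ {1,…,n} and Γ;Δ_k ⊢ C_k for each k ∈ {1,…,m}, infer Γ;Δ₁,…,Δ_m ⊢ A; and BC_b: under the same side condition, from the same premises, infer Γ;Δ₁,…,Δ_m,B ⊢ A (here the copy of B is taken from the bounded context); in both rules n,m ≥ 0. -/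

import Mathlib

/- The language of Lolli.  `α` is the type of atomic formulas and `T` is the
type of first-order terms; quantification is represented in higher-order
abstract syntax over `T`, so that the substitution `B[t/x]` appearing in the
∀L and ∃R rules is function application, and the eigenvariable condition of
∀R is expressed by quantifying over all terms. -/
mutual

/-- Program clause formulas: `P ::= A | P & P | G ⊸ P | G ⇒ P | ∀x.P`. -/
inductive PF (α T : Type) : Type
  | atom : α → PF α T
  | conj : PF α T → PF α T → PF α T
  | limp : GF α T → PF α T → PF α T     -- `G ⊸ P`
  | imp  : GF α T → PF α T → PF α T     -- `G ⇒ P`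
  | all  : (T → PF α T) → PF α T

/-- Goal formulas:
`G ::= ⊤ | A | G & G | P ⊸ G | P ⇒ G | ∀x.G | ∃x.G | !G | G ⊗ G | G ⊕ G`. -/
inductive GF (α T : Type) : Type
  | top  : GF α T
  | atom : α → GF α T
  | conj : GF α T → GF α T → GF α T
  | limp : PF α T → GF α T → GF α T     -- `P ⊸ G`
  | imp  : PF α T → GF α T → GF α T     -- `P ⇒ G`
  | all  : (T → GF α T) → GF α T
  | ex   : (T → GF α T) → GF α T
  | bang : GF α T → GF α T
  | tensor : GF α T → GF α T → GF α T
  | oplus  : GF α T → GF α T → GF α T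

end

/-- Provability of the Lolli sequent `Γ ; Δ ⊢ G`, where `Γ` is the unbounded
context (a set of program clauses), `Δ` is the bounded context (a multiset of
program clauses) and `G` is a goal formula. -/
inductive Prov {α T : Type} : Set (PF α T) → Multiset (PF α T) → GF α T → Prop
  | id (Γ : Set (PF α T)) (a : α) : Prov Γ {PF.atom a} (GF.atom a)
  | absorb {Γ Δ G} {B : PF α T} : B ∈ Γ → Prov Γ (B ::ₘ Δ) G → Prov Γ Δ G
  | topR (Γ : Set (PF α T)) (Δ : Multiset (PF α T)) : Prov Γ Δ GF.top
  | conjL₁ {Γ Δ G} {B₁ B₂ : PF α T} :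
      Prov Γ (B₁ ::ₘ Δ) G → Prov Γ (PF.conj B₁ B₂ ::ₘ Δ) G
  | conjL₂ {Γ Δ G} {B₁ B₂ : PF α T} :
      Prov Γ (B₂ ::ₘ Δ) G → Prov Γ (PF.conj B₁ B₂ ::ₘ Δ) G
  | conjR {Γ Δ} {G₁ G₂ : GF α T} :
      Prov Γ Δ G₁ → Prov Γ Δ G₂ → Prov Γ Δ (GF.conj G₁ G₂)
  | limpL {Γ Δ₁ Δ₂ G} {G₁ : GF α T} {B₂ : PF α T} :
      Prov Γ Δ₁ G₁ → Prov Γ (B₂ ::ₘ Δ₂) G →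
      Prov Γ (PF.limp G₁ B₂ ::ₘ (Δ₁ + Δ₂)) G
  | limpR {Γ Δ} {B : PF α T} {G : GF α T} :
      Prov Γ (B ::ₘ Δ) G → Prov Γ Δ (GF.limp B G)
  | impL {Γ Δ G} {G₁ : GF α T} {B₂ : PF α T} :
      Prov Γ 0 G₁ → Prov Γ (B₂ ::ₘ Δ) G → Prov Γ (PF.imp G₁ B₂ ::ₘ Δ) G
  | impR {Γ Δ} {B : PF α T} {G : GF α T} :
      Prov (insert B Γ) Δ G → Prov Γ Δ (GF.imp B G)
  | allL {Γ Δ G} {B : T → PF α T} (t : T) :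
      Prov Γ (B t ::ₘ Δ) G → Prov Γ (PF.all B ::ₘ Δ) G
  | allR {Γ Δ} {G : T → GF α T} :
      (∀ t : T, Prov Γ Δ (G t)) → Prov Γ Δ (GF.all G)
  | exR {Γ Δ} {G : T → GF α T} (t : T) : Prov Γ Δ (G t) → Prov Γ Δ (GF.ex G)
  | bangR {Γ} {G : GF α T} : Prov Γ 0 G → Prov Γ 0 (GF.bang G)
  | oplusR₁ {Γ Δ} {G₁ G₂ : GF α T} : Prov Γ Δ G₁ → Prov Γ Δ (GF.oplus G₁ G₂)
  | oplusR₂ {Γ Δ} {G₁ G₂ : GF α T} : Prov Γ Δ G₂ → Prov Γ Δ (GF.oplus G₁ G₂)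
  | tensorR {Γ Δ₁ Δ₂} {G₁ G₂ : GF α T} :
      Prov Γ Δ₁ G₁ → Prov Γ Δ₂ G₂ → Prov Γ (Δ₁ + Δ₂) (GF.tensor G₁ G₂)

/-- The elaboration set `||P||` of a program clause `P`: the smallest set of
triples `⟨Γ', Δ', P'⟩` (with `Γ'` a set of goal formulas — the unbounded proof
obligations — `Δ'` a multiset of goal formulas — the bounded proof
obligations — and `P'` a program clause formula) that contains `⟨∅, ∅, P⟩`
and is closed under decomposing `&`, `∀`, `⇒` and `⊸` on the right. -/
inductive Elab {α T : Type} (P : PF α T) :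
    Set (GF α T) → Multiset (GF α T) → PF α T → Prop
  | base : Elab P ∅ 0 P
  | conj₁ {Γ' Δ' P₁ P₂} : Elab P Γ' Δ' (PF.conj P₁ P₂) → Elab P Γ' Δ' P₁
  | conj₂ {Γ' Δ' P₁ P₂} : Elab P Γ' Δ' (PF.conj P₁ P₂) → Elab P Γ' Δ' P₂
  | all {Γ' Δ'} {B : T → PF α T} (t : T) :
      Elab P Γ' Δ' (PF.all B) → Elab P Γ' Δ' (B t)
  | imp {Γ' Δ' G P'} : Elab P Γ' Δ' (PF.imp G P') → Elab P (insert G Γ') Δ' P'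
  | limp {Γ' Δ' G P'} : Elab P Γ' Δ' (PF.limp G P') → Elab P Γ' (G ::ₘ Δ') P'

/-- Provability in the backchaining specification logic: all the
right-introduction rules of Lolli together with the two backchaining rules
`BC_u` and `BC_b`.  In the backchaining rules, `⟨{B₁,…,Bₙ}, {C₁,…,C_m}, A⟩ ∈
||B||`; the premises are `Γ ; ∅ ⊢ Bⱼ` for each unbounded obligation `Bⱼ` and
`Γ ; Δₖ ⊢ Cₖ` for each bounded obligation `Cₖ`; the bounded context of the
conclusion is `Δ₁, …, Δ_m` (for `BC_u`, where `B ∈ Γ`), respectively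
`Δ₁, …, Δ_m, B` (for `BC_b`, where the copy of `B` is taken from the bounded
context).  The association of each bounded obligation `Cₖ` with its piece
`Δₖ` of the bounded context is recorded by the multiset `pairs` of pairs. -/
inductive SpecProv {α T : Type} :
    Set (PF α T) → Multiset (PF α T) → GF α T → Prop
  | topR (Γ : Set (PF α T)) (Δ : Multiset (PF α T)) : SpecProv Γ Δ GF.top
  | conjR {Γ Δ} {G₁ G₂ : GF α T} :
      SpecProv Γ Δ G₁ → SpecProv Γ Δ G₂ → SpecProv Γ Δ (GF.conj G₁ G₂)
  | limpR {Γ Δ} {B : PF α T} {G : GF α T} :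
      SpecProv Γ (B ::ₘ Δ) G → SpecProv Γ Δ (GF.limp B G)
  | impR {Γ Δ} {B : PF α T} {G : GF α T} :
      SpecProv (insert B Γ) Δ G → SpecProv Γ Δ (GF.imp B G)
  | allR {Γ Δ} {G : T → GF α T} :
      (∀ t : T, SpecProv Γ Δ (G t)) → SpecProv Γ Δ (GF.all G)
  | exR {Γ Δ} {G : T → GF α T} (t : T) :
      SpecProv Γ Δ (G t) → SpecProv Γ Δ (GF.ex G)
  | bangR {Γ} {G : GF α T} : SpecProv Γ 0 G → SpecProv Γ 0 (GF.bang G)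
  | oplusR₁ {Γ Δ} {G₁ G₂ : GF α T} :
      SpecProv Γ Δ G₁ → SpecProv Γ Δ (GF.oplus G₁ G₂)
  | oplusR₂ {Γ Δ} {G₁ G₂ : GF α T} :
      SpecProv Γ Δ G₂ → SpecProv Γ Δ (GF.oplus G₁ G₂)
  | tensorR {Γ Δ₁ Δ₂} {G₁ G₂ : GF α T} :
      SpecProv Γ Δ₁ G₁ → SpecProv Γ Δ₂ G₂ →
      SpecProv Γ (Δ₁ + Δ₂) (GF.tensor G₁ G₂)
  | bcU {Γ : Set (PF α T)} {B : PF α T} {Γ' : Set (GF α T)}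
      {Δ' : Multiset (GF α T)} {a : α}
      (pairs : Multiset (GF α T × Multiset (PF α T))) :
      B ∈ Γ → Elab B Γ' Δ' (PF.atom a) →
      (∀ g ∈ Γ', SpecProv Γ 0 g) →
      pairs.map Prod.fst = Δ' →
      (∀ pr ∈ pairs, SpecProv Γ pr.2 pr.1) →
      SpecProv Γ (pairs.map Prod.snd).sum (GF.atom a)
  | bcB {Γ : Set (PF α T)} {B : PF α T} {Γ' : Set (GF α T)}
      {Δ' : Multiset (GF α T)} {a : α}
      (pairs : Multiset (GF α T × Multiset (PF α T))) :
      Elab B Γ' Δ' (PF.atom a) →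
      (∀ g ∈ Γ', SpecProv Γ 0 g) →
      pairs.map Prod.fst = Δ' →
      (∀ pr ∈ pairs, SpecProv Γ pr.2 pr.1) →
      SpecProv Γ (B ::ₘ (pairs.map Prod.snd).sum) (GF.atom a)

/-- Elaborations compose: obligations accumulate along a chain of decompositions. -/
theorem Elab.trans {α T : Type} {P Q R : PF α T} {Γ₁ Γ₂ : Set (GF α T)}
    {Δ₁ Δ₂ : Multiset (GF α T)} (h₁ : Elab P Γ₁ Δ₁ Q) (h₂ : Elab Q Γ₂ Δ₂ R) :
    Elab P (Γ₁ ∪ Γ₂) (Δ₁ + Δ₂) R := by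
  induction h₂ with
  | base => simpa using h₁
  | conj₁ _ ih => exact ih.conj₁
  | conj₂ _ ih => exact ih.conj₂
  | all t _ ih => exact ih.all t
  | imp _ ih => rw [Set.union_insert]; exact ih.imp
  | limp _ ih => rw [Multiset.add_cons]; exact ih.limp

/-- A clause can be used on the left in place of any of its elaborations, provided the
corresponding obligations are provable. -/
theorem Elab.prov_left {α T : Type} {Γ : Set (PF α T)} {P Q : PF α T} {Γ' : Set (GF α T)}
    {Δ' : Multiset (GF α T)} (h : Elab P Γ' Δ' Q) :
    ∀ (pairs : Multiset (GF α T × Multiset (PF α T))) (Δ : Multiset (PF α T)) (G : GF α T),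
      (∀ g ∈ Γ', Prov Γ 0 g) → pairs.map Prod.fst = Δ' → (∀ pr ∈ pairs, Prov Γ pr.2 pr.1) →
      Prov Γ (Q ::ₘ Δ) G → Prov Γ (P ::ₘ ((pairs.map Prod.snd).sum + Δ)) G := by
  induction h with
  | base =>
    intro pairs Δ G _ hp _ hG
    obtain rfl := Multiset.map_eq_zero.mp hp
    simpa using hG
  | conj₁ _ ih => exact fun pairs Δ G hu hp hb hG => ih pairs Δ G hu hp hb hG.conjL₁
  | conj₂ _ ih => exact fun pairs Δ G hu hp hb hG => ih pairs Δ G hu hp hb hG.conjL₂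
  | all t _ ih => exact fun pairs Δ G hu hp hb hG => ih pairs Δ G hu hp hb (hG.allL t)
  | imp _ ih =>
    intro pairs Δ G hu hp hb hG
    exact ih pairs Δ G (fun g hg => hu g (Set.mem_insert_of_mem _ hg)) hp hb
      (Prov.impL (hu _ (Set.mem_insert _ _)) hG)
  | limp _ ih =>
    intro pairs Δ G hu hp hb hG
    obtain ⟨⟨_, Δ₁⟩, hpr, rfl⟩ := Multiset.mem_map.mp (hp ▸ Multiset.mem_cons_self _ _)
    obtain ⟨rest, rfl⟩ := Multiset.exists_cons_of_mem hpr
    have := ih rest (Δ₁ + Δ) G hu (by simpa using hp)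
      (fun q hq => hb q (Multiset.mem_cons_of_mem hq))
      (Prov.limpL (hb _ (Multiset.mem_cons_self _ _)) hG)
    simpa [add_assoc, add_left_comm] using this

theorem SpecProv.toProv {α T : Type} {Γ : Set (PF α T)} {Δ : Multiset (PF α T)} {G : GF α T}
    (h : SpecProv Γ Δ G) : Prov Γ Δ G := by
  induction h with
  | topR Γ Δ => exact .topR Γ Δ
  | conjR _ _ ih₁ ih₂ => exact .conjR ih₁ ih₂
  | limpR _ ih => exact .limpR ih
  | impR _ ih => exact .impR ih
  | allR _ ih => exact .allR ih
  | exR t _ ih => exact .exR t ih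
  | bangR _ ih => exact .bangR ih
  | oplusR₁ _ ih => exact .oplusR₁ ih
  | oplusR₂ _ ih => exact .oplusR₂ ih
  | tensorR _ _ ih₁ ih₂ => exact .tensorR ih₁ ih₂
  | bcU pairs hB hE _ hp _ ihu ihb =>
    exact .absorb hB (by simpa using hE.prov_left pairs 0 _ ihu hp ihb (.id _ _))
  | bcB pairs hE _ hp _ ihu ihb =>
    simpa using hE.prov_left pairs 0 _ ihu hp ihb (.id _ _)

/-- Weakening of the unbounded context. -/
theorem SpecProv.mono {α T : Type} {Γ : Set (PF α T)} {Δ : Multiset (PF α T)} {G : GF α T}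
    (h : SpecProv Γ Δ G) : ∀ {Γ₂ : Set (PF α T)}, Γ ⊆ Γ₂ → SpecProv Γ₂ Δ G := by
  induction h with
  | topR Γ Δ => exact fun _ => .topR _ Δ
  | conjR _ _ ih₁ ih₂ => exact fun hs => .conjR (ih₁ hs) (ih₂ hs)
  | limpR _ ih => exact fun hs => .limpR (ih hs)
  | impR _ ih => exact fun hs => .impR (ih (Set.insert_subset_insert hs))
  | allR _ ih => exact fun hs => .allR fun t => ih t hs
  | exR t _ ih => exact fun hs => .exR t (ih hs)
  | bangR _ ih => exact fun hs => .bangR (ih hs)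
  | oplusR₁ _ ih => exact fun hs => .oplusR₁ (ih hs)
  | oplusR₂ _ ih => exact fun hs => .oplusR₂ (ih hs)
  | tensorR _ _ ih₁ ih₂ => exact fun hs => .tensorR (ih₁ hs) (ih₂ hs)
  | bcU pairs hB hE _ hp _ ihu ihb =>
    exact fun hs => .bcU pairs (hs hB) hE (fun g hg => ihu g hg hs) hp (fun q hq => ihb q hq hs)
  | bcB pairs hE _ hp _ ihu ihb =>
    exact fun hs => .bcB pairs hE (fun g hg => ihu g hg hs) hp (fun q hq => ihb q hq hs)

/-- An element of a sum of multisets comes from one of the summands. -/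
theorem exists_cons_of_sum_map_snd_eq_cons {β γ : Type} {b : γ} {D : Multiset γ}
    {pairs : Multiset (β × Multiset γ)} (h : (pairs.map Prod.snd).sum = b ::ₘ D) :
    ∃ c E rest, pairs = (c, b ::ₘ E) ::ₘ rest ∧ D = E + (rest.map Prod.snd).sum := by
  have hb : b ∈ (pairs.map Prod.snd).join := by
    change b ∈ (pairs.map Prod.snd).sum
    simp [h]
  obtain ⟨_, hs, hbs⟩ := Multiset.mem_join.mp hb
  obtain ⟨⟨c, F⟩, hpr, rfl⟩ := Multiset.mem_map.mp hs
  obtain ⟨rest, rfl⟩ := Multiset.exists_cons_of_mem hpr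
  obtain ⟨E, rfl : F = _⟩ := Multiset.exists_cons_of_mem hbs
  refine ⟨c, E, rest, rfl, ?_⟩
  simpa using h.symm

/-- If a multiset `E` can stand in for the clause `B` whenever `B` is the focus of a bounded
backchaining step, then it can stand in for `B` in every derivation. -/
theorem SpecProv.replace {α T : Type} {B : PF α T} {E : Multiset (PF α T)}
    {Γ : Set (PF α T)} {Δ₀ : Multiset (PF α T)} {G : GF α T} (h : SpecProv Γ Δ₀ G) :
    (∀ Γ₂, Γ ⊆ Γ₂ → ∀ (Γ' : Set (GF α T)) (pairs : Multiset (GF α T × Multiset (PF α T))) (a : α),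
      Elab B Γ' (pairs.map Prod.fst) (PF.atom a) → (∀ g ∈ Γ', SpecProv Γ₂ 0 g) →
      (∀ pr ∈ pairs, SpecProv Γ₂ pr.2 pr.1) →
      SpecProv Γ₂ (E + (pairs.map Prod.snd).sum) (GF.atom a)) →
    ∀ Δ, Δ₀ = B ::ₘ Δ → SpecProv Γ (E + Δ) G := by
  induction h with
  | topR Γ Δ => exact fun _ _ _ => .topR _ _
  | conjR _ _ ih₁ ih₂ => exact fun H Δ hΔ => .conjR (ih₁ H Δ hΔ) (ih₂ H Δ hΔ)
  | @limpR _ _ C _ _ ih =>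
    intro H Δ hΔ
    refine .limpR ?_
    rw [← Multiset.add_cons]
    exact ih H (C ::ₘ Δ) (by rw [hΔ, Multiset.cons_swap])
  | impR _ ih =>
    exact fun H Δ hΔ =>
      .impR (ih (fun Γ₂ hs => H Γ₂ ((Set.subset_insert _ _).trans hs)) Δ hΔ)
  | allR _ ih => exact fun H Δ hΔ => .allR fun t => ih t H Δ hΔ
  | exR t _ ih => exact fun H Δ hΔ => .exR t (ih H Δ hΔ)
  | bangR _ _ => exact fun _ _ hΔ => absurd hΔ (Multiset.zero_ne_cons)
  | oplusR₁ _ ih => exact fun H Δ hΔ => .oplusR₁ (ih H Δ hΔ)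
  | oplusR₂ _ ih => exact fun H Δ hΔ => .oplusR₂ (ih H Δ hΔ)
  | @tensorR _ Δ₁ Δ₂ _ _ h₁ h₂ ih₁ ih₂ =>
    intro H Δ hΔ
    have hB : B ∈ Δ₁ + Δ₂ := by simp [hΔ]
    rcases Multiset.mem_add.mp hB with hB | hB
    · obtain ⟨D, rfl⟩ := Multiset.exists_cons_of_mem hB
      obtain rfl : D + Δ₂ = Δ := by simpa using hΔ
      rw [← add_assoc]
      exact .tensorR (ih₁ H D rfl) h₂
    · obtain ⟨D, rfl⟩ := Multiset.exists_cons_of_mem hB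
      obtain rfl : Δ₁ + D = Δ := by simpa using hΔ
      rw [add_left_comm]
      exact .tensorR h₁ (ih₂ H D rfl)
  | bcU pairs hC hE hu hp hb _ ihb =>
    intro H Δ hΔ
    obtain ⟨c, D, rest, rfl, rfl⟩ := exists_cons_of_sum_map_snd_eq_cons hΔ
    have := SpecProv.bcU ((c, E + D) ::ₘ rest) hC hE hu (by simpa using hp) (by
      rintro q hq
      rcases Multiset.mem_cons.mp hq with rfl | hq
      · exact ihb _ (Multiset.mem_cons_self _ _) H D rfl
      · exact hb q (Multiset.mem_cons_of_mem hq))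
    simpa [add_assoc] using this
  | bcB pairs hE hu hp hb _ ihb =>
    intro H Δ hΔ
    rcases Multiset.cons_eq_cons.mp hΔ with ⟨rfl, rfl⟩ | ⟨_, F, hF, rfl⟩
    · subst hp
      exact H _ subset_rfl _ pairs _ hE hu hb
    · obtain ⟨c, D, rest, rfl, rfl⟩ := exists_cons_of_sum_map_snd_eq_cons hF
      have := SpecProv.bcB ((c, E + D) ::ₘ rest) hE hu (by simpa using hp) (by
        rintro q hq
        rcases Multiset.mem_cons.mp hq with rfl | hq
        · exact ihb _ (Multiset.mem_cons_self _ _) H D rfl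
        · exact hb q (Multiset.mem_cons_of_mem hq))
      simpa [add_assoc] using this

/-- Absorption is admissible in the specification logic. -/
theorem SpecProv.absorb {α T : Type} {Γ : Set (PF α T)} {Δ : Multiset (PF α T)} {G : GF α T}
    {B : PF α T} (hB : B ∈ Γ) (h : SpecProv Γ (B ::ₘ Δ) G) : SpecProv Γ Δ G := by
  have := h.replace (E := 0) (fun Γ₂ hs Γ' pairs a hE hu hb => by
    rw [zero_add]
    exact .bcU pairs (hs hB) hE hu rfl hb) Δ rfl
  simpa using this

/-- All left rules are admissible in the specification logic: a clause may replace any of its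
elaborations whose obligations are provable. -/
theorem SpecProv.left_admissible {α T : Type} {Γ : Set (PF α T)} {Δ : Multiset (PF α T)} {G : GF α T}
    {P Q : PF α T} {Γ₀ : Set (GF α T)} (pairs₀ : Multiset (GF α T × Multiset (PF α T)))
    (hE₀ : Elab P Γ₀ (pairs₀.map Prod.fst) Q) (hu₀ : ∀ g ∈ Γ₀, SpecProv Γ 0 g)
    (hb₀ : ∀ pr ∈ pairs₀, SpecProv Γ pr.2 pr.1) (h : SpecProv Γ (Q ::ₘ Δ) G) :
    SpecProv Γ (P ::ₘ ((pairs₀.map Prod.snd).sum + Δ)) G := by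
  have := h.replace (E := P ::ₘ (pairs₀.map Prod.snd).sum)
    (fun Γ₂ hs Γ' pairs a hE hu hb => by
      have := SpecProv.bcB (pairs₀ + pairs) (hE₀.trans hE)
        (fun g hg => hg.elim (fun hg => (hu₀ g hg).mono hs) (hu g))
        (by simp)
        (fun q hq => (Multiset.mem_add.mp hq).elim (fun hq => (hb₀ q hq).mono hs) (hb q))
      simpa using this) Δ rfl
  simpa using this

theorem Prov.toSpecProv {α T : Type} {Γ : Set (PF α T)} {Δ : Multiset (PF α T)} {G : GF α T}
    (h : Prov Γ Δ G) : SpecProv Γ Δ G := by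
  induction h with
  | id Γ a => exact .bcB 0 .base (by simp) rfl (by simp)
  | absorb hB _ ih => exact ih.absorb hB
  | topR Γ Δ => exact .topR Γ Δ
  | conjL₁ _ ih => simpa using ih.left_admissible 0 (.conj₁ .base) (by simp) (by simp)
  | conjL₂ _ ih => simpa using ih.left_admissible 0 (.conj₂ .base) (by simp) (by simp)
  | conjR _ _ ih₁ ih₂ => exact .conjR ih₁ ih₂
  | @limpL _ Δ₁ _ _ G₁ _ _ _ ih₁ ih₂ =>
    simpa using ih₂.left_admissible {(G₁, Δ₁)} (.limp .base) (by simp) (by simpa using ih₁)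
  | limpR _ ih => exact .limpR ih
  | impL _ _ ih₁ ih₂ =>
    simpa using ih₂.left_admissible 0 (.imp .base) (by simpa using ih₁) (by simp)
  | impR _ ih => exact .impR ih
  | allL t _ ih => simpa using ih.left_admissible 0 (.all t .base) (by simp) (by simp)
  | allR _ ih => exact .allR ih
  | exR t _ ih => exact .exR t ih
  | bangR _ ih => exact .bangR ih
  | oplusR₁ _ ih => exact .oplusR₁ ih
  | oplusR₂ _ ih => exact .oplusR₂ ih
  | tensorR _ _ ih₁ ih₂ => exact .tensorR ih₁ ih₂

/-- **Equivalence of Lolli and the backchaining specification logic**: a Lolli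
sequent `Γ ; Δ ⊢ G` is provable in Lolli if and only if it is provable in the
specification logic. -/
theorem lolli_equiv_specification_logic {α T : Type}
    (Γ : Set (PF α T)) (Δ : Multiset (PF α T)) (G : GF α T) :
    Prov Γ Δ G ↔ SpecProv Γ Δ G :=
  ⟨Prov.toSpecProv, SpecProv.toProv⟩
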